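/- Let μ be a complex number and n ≥ 1 an integer. Then D1(2n) · (n)_n · (½(−μ−4n+3))_{⌊(n−1)/2⌋} = (−1)^{(n−1)(n−2)/2} · 2^n · (½(μ+2n))_{⌊(n+1)/2⌋} · (½(μ+4n+1))_{n−1} · D1(2n−1). (In particular, whenever the right factors are nonzero, D1(2n)/D1(2n−1) = (−1)^{(n−1)(n−2)/2} 2^n (½(μ+2n))_{⌊(n+1)/2⌋} (½(μ+4n+1))_{n−1} / ( (n)_n (½(−μ−4n+3))_{⌊(n−1)/2⌋} ).) -/

import Mathlib

/-- Generalized binomial coefficient `C(x,k) = x(x-1)⋯(x-k+1)/k!` for complex `x`. -/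
noncomputable def gbinom (x : ℂ) (k : ℕ) : ℂ :=
  (∏ i ∈ Finset.range k, (x - i)) / (k.factorial : ℂ)

/-- Pochhammer symbol `(x)_k = x(x+1)⋯(x+k-1)`. -/
noncomputable def poch (x : ℂ) (k : ℕ) : ℂ :=
  ∏ i ∈ Finset.range k, (x + i)

/-- `D1(m)`: determinant of the `m×m` matrix with rows and columns indexed by
`1,…,m` and entries `δ_{i,j} + C(μ+i+j-2, j)`. -/
noncomputable def D1 (μ : ℂ) (m : ℕ) : ℂ :=
  Matrix.det (Matrix.of fun i j : Fin m =>
    (if i = j then (1 : ℂ) else 0)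
      + gbinom (μ + ((i.1 : ℂ) + 1) + ((j.1 : ℂ) + 1) - 2) (j.1 + 1))

open Polynomial

/-- The coefficients of `(1 - X) ^ b`. -/
theorem coeff_one_sub_X_pow' (b r : ℕ) :
    ((1 - X : ℂ[X]) ^ b).coeff r = (-1) ^ r * (b.choose r : ℂ) := by
  have h : (1 - X : ℂ[X]) ^ b = ((1 + X : ℂ[X]) ^ b).comp (C (-1) * X) := by
    simp [sub_eq_add_neg]
  rw [h, comp_C_mul_X_coeff, coeff_one_add_X_pow, mul_comm]

theorem poch_zero (x : ℂ) : poch x 0 = 1 := by simp [poch]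

theorem poch_succ (x : ℂ) (k : ℕ) : poch x (k + 1) = poch x k * (x + k) := by
  simp [poch, Finset.prod_range_succ]

theorem poch_add (x : ℂ) (j k : ℕ) : poch x (j + k) = poch x j * poch (x + j) k := by
  simp only [poch, Finset.prod_range_add]
  congr 1
  exact Finset.prod_congr rfl fun i _ => by push_cast; ring

theorem poch_succ_left (x : ℂ) (k : ℕ) : poch x (k + 1) = x * poch (x + 1) k := by
  rw [add_comm, poch_add]
  simp [poch]

theorem poch_neg (x : ℂ) (k : ℕ) : poch (-x) k = (-1) ^ k * poch (x - k + 1) k := by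
  induction k generalizing x with
  | zero => simp [poch]
  | succ k ih =>
    rw [poch_succ, ih, poch_succ_left]
    push_cast
    rw [show x - (k + 1) + 1 + 1 = x - k + 1 by ring]
    ring

theorem poch_double (x : ℂ) (k : ℕ) :
    poch x (2 * k) = 2 ^ (2 * k) * poch (x / 2) k * poch ((x + 1) / 2) k := by
  induction k with
  | zero => simp [poch]
  | succ k ih =>
    rw [mul_add_one, poch_succ, poch_succ, ih, poch_succ, poch_succ]
    push_cast
    ring

theorem poch_split_parity (x : ℂ) (n : ℕ) :
    poch x n = 2 ^ n * poch (x / 2) ((n + 1) / 2) * poch ((x + 1) / 2) (n / 2) := by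
  obtain ⟨k, rfl | rfl⟩ := n.even_or_odd'
  · rw [poch_double, show (2 * k + 1) / 2 = k by lia, show 2 * k / 2 = k by lia]
  · rw [poch_succ, poch_double, show (2 * k + 1 + 1) / 2 = k + 1 by lia,
      show (2 * k + 1) / 2 = k by lia, poch_succ]
    push_cast
    ring

theorem poch_ne_zero {x : ℂ} {k : ℕ} (h : ∀ i < k, x + i ≠ 0) : poch x k ≠ 0 :=
  Finset.prod_ne_zero_iff.2 fun i hi => h i (Finset.mem_range.1 hi)

theorem saalschutz_partial (a b c : ℂ) (N J : ℕ) (hJ : J ≤ N) :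
    ∑ j ∈ Finset.range (J + 1),
      (((N + 1).choose j : ℂ) * poch a j * poch b j * poch (c + j) (N + 1 - j)
          * poch (c - a - b) (N + 1 - j)
        - (c - a + N) * (c - b + N) * ((N.choose j : ℂ) * poch a j * poch b j
          * poch (c + j) (N - j) * poch (c - a - b) (N - j)))
      = -((N.choose J : ℂ) * poch a (J + 1) * poch b (J + 1) * poch (c + J) (N - J)
          * poch (c - a - b) (N - J)) := by
  induction J with
  | zero => simp [poch_succ, poch_zero]; ring
  | succ J ih =>
    rw [Finset.sum_range_succ, ih (by lia)]
    obtain ⟨r, rfl⟩ := Nat.exists_eq_add_of_le hJ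
    rw [show J + 1 + r - J = r + 1 by lia, show J + 1 + r + 1 - (J + 1) = r + 1 by lia,
      show J + 1 + r - (J + 1) = r by lia]
    have h1 : (((J + 1 + r + 1).choose (J + 1) : ℕ) : ℂ)
        = (J + 1 + r).choose J + (J + 1 + r).choose (J + 1) := by
      exact_mod_cast Nat.choose_succ_succ _ _
    have h2 : ((J + 1 + r).choose (J + 1) : ℂ) * (J + 1) = (J + 1 + r).choose J * (r + 1) := by
      have := Nat.choose_succ_right_eq (J + 1 + r) J
      rw [show J + 1 + r - J = r + 1 by lia] at this
      exact_mod_cast this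
    rw [h1, poch_succ_left (c + J) r, poch_succ (c + (J + 1 : ℕ)) r, poch_succ (c - a - b) r,
      poch_succ a (J + 1), poch_succ b (J + 1)]
    push_cast
    rw [show c + (J : ℂ) + 1 = c + (J + 1) by ring]
    linear_combination -(c - a - b + r) * (poch a (J + 1) * poch b (J + 1)
      * poch (c + (J + 1)) r * poch (c - a - b) r) * h2

/-- The Pfaff–Saalschütz summation, with cleared denominators. -/
theorem saalschutz (a b c : ℂ) (N : ℕ) :
    ∑ j ∈ Finset.range (N + 1), (N.choose j : ℂ) * poch a j * poch b j
      * poch (c + j) (N - j) * poch (c - a - b) (N - j) = poch (c - a) N * poch (c - b) N := by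
  induction N with
  | zero => simp [poch]
  | succ N ih =>
    have h := saalschutz_partial a b c N N le_rfl
    rw [Finset.sum_sub_distrib, ← Finset.mul_sum, ih] at h
    rw [Finset.sum_range_succ, poch_succ (c - a), poch_succ (c - b)]
    simp only [Nat.choose_self, Nat.sub_self, poch_zero] at h ⊢
    linear_combination h

/-- If a combination of the rows of a square matrix vanishes in all columns but the last one,
its value there gives the quotient of the two largest leading principal minors. -/
theorem Matrix.det_mul_of_vecMul_eq_zero {R : Type*} [CommRing R] (m : ℕ)
    (A : Matrix (Fin (m + 1)) (Fin (m + 1)) R) (c : Fin (m + 1) → R) (S : R)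
    (h : ∀ j, ∑ i, c i * A i j = if j = Fin.last m then S else 0) :
    c (Fin.last m) * A.det = S * (A.submatrix Fin.castSucc Fin.castSucc).det := by
  rw [← smul_eq_mul, ← Matrix.det_updateRow_sum, Matrix.det_succ_row _ (Fin.last m),
    Finset.sum_eq_single (Fin.last m)]
  · have hs : (A.updateRow (Fin.last m) (∑ k, c k • A k)).submatrix Fin.castSucc Fin.castSucc
        = A.submatrix Fin.castSucc Fin.castSucc := by
      ext i j
      simp
    simp only [Matrix.updateRow_self, Finset.sum_apply, Pi.smul_apply, smul_eq_mul, h,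
      Fin.succAbove_last, hs, if_true]
    rw [← two_mul, pow_mul]
    simp
  · intro j _ hj
    simp [Matrix.updateRow_self, Finset.sum_apply, h, hj]
  · simp

/-- The linear map sending `X ^ i` to `(1 - X) ^ (M - i)` for `i ≤ K`. -/
noncomputable def reflectMap (K M : ℕ) (f : ℂ[X]) : ℂ[X] :=
  ∑ i ∈ Finset.range (K + 1), C (f.coeff i) * (1 - X) ^ (M - i)

theorem reflectMap_sub (K M : ℕ) (f g : ℂ[X]) :
    reflectMap K M (f - g) = reflectMap K M f - reflectMap K M g := by
  simp [reflectMap, sub_mul, Finset.sum_sub_distrib]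

theorem reflectMap_sum_C_mul (K M : ℕ) (s : Finset ℕ) (p : ℕ → ℂ) (f : ℕ → ℂ[X]) :
    reflectMap K M (∑ k ∈ s, C (p k) * f k) = ∑ k ∈ s, C (p k) * reflectMap K M (f k) := by
  simp only [reflectMap, finsetSum_coeff, coeff_C_mul, map_sum, map_mul, Finset.sum_mul,
    Finset.mul_sum, mul_assoc]
  exact Finset.sum_comm

theorem reflectMap_X_pow_mul (K M : ℕ) (hKM : K ≤ M) (a l : ℕ) (h : a + l ≤ K) :
    reflectMap K M (X ^ a * (1 - X) ^ l) = (-X) ^ l * (1 - X) ^ (M - a - l) := by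
  induction l generalizing a with
  | zero => simp [reflectMap, coeff_X_pow, Nat.lt_succ_of_le (show a ≤ K by lia)]
  | succ l ih =>
    rw [show (X ^ a * (1 - X) ^ (l + 1) : ℂ[X])
        = X ^ a * (1 - X) ^ l - X ^ (a + 1) * (1 - X) ^ l by ring,
      reflectMap_sub, ih a (by lia), ih (a + 1) (by lia)]
    obtain ⟨r, rfl⟩ := Nat.exists_eq_add_of_le (show a + (l + 1) ≤ M by lia)
    rw [show a + (l + 1) + r - a - l = r + 1 by lia, show a + (l + 1) + r - (a + 1) - l = r by lia,
      show a + (l + 1) + r - a - (l + 1) = r by lia]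
    ring

/-- `gbinom` at the arguments of the Andrews matrix with `μ = 1 - M`. -/
theorem gbinom_neg (M i j : ℕ) (h : i ≤ M) :
    gbinom (1 - (M : ℂ) + i + j - 2) j = ((1 - X : ℂ[X]) ^ (M - i)).coeff j := by
  rw [coeff_one_sub_X_pow', gbinom, Nat.cast_choose_eq_descPochhammer_div,
    descPochhammer_eval_eq_prod_range, ← mul_div_assoc, ← Finset.prod_range_reflect]
  congr 1
  rw [← Finset.card_range j, ← Finset.prod_const, Finset.card_range, ← Finset.prod_mul_distrib]
  refine Finset.prod_congr rfl fun l hl => ?_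
  have hl' := Finset.mem_range.1 hl
  rw [Nat.cast_sub h, Nat.cast_sub (by lia), Nat.cast_sub (by lia)]
  push_cast
  ring

theorem D1_mul_of_coeff_eq_zero (m M : ℕ) (hM : m + 1 ≤ M) (P : ℂ[X])
    (hP0 : P.coeff 0 = 0)
    (h : ∀ j, j < m + 1 → (P + reflectMap (m + 1) M P).coeff j = 0) :
    P.coeff (m + 1) * D1 (1 - M) (m + 1)
      = (P + reflectMap (m + 1) M P).coeff (m + 1) * D1 (1 - M) m := by
  have key := Matrix.det_mul_of_vecMul_eq_zero m
    (Matrix.of fun i j : Fin (m + 1) => (if i = j then (1 : ℂ) else 0)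
      + gbinom (1 - M + ((i.1 : ℂ) + 1) + ((j.1 : ℂ) + 1) - 2) (j.1 + 1))
    (fun i => P.coeff (i + 1)) ((P + reflectMap (m + 1) M P).coeff (m + 1)) ?_
  · have hm : D1 (1 - M) m = ((Matrix.of fun i j : Fin (m + 1) => (if i = j then (1 : ℂ) else 0)
        + gbinom (1 - M + ((i.1 : ℂ) + 1) + ((j.1 : ℂ) + 1) - 2) (j.1 + 1)).submatrix
          Fin.castSucc Fin.castSucc).det := by
      rw [D1]
      congr 1
      ext i j
      simp
    rw [hm]
    exact key
  · intro j
    have hj : ∑ i : Fin (m + 1), P.coeff (i + 1) * (Matrix.of fun i j : Fin (m + 1) =>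
        (if i = j then (1 : ℂ) else 0)
          + gbinom (1 - M + ((i.1 : ℂ) + 1) + ((j.1 : ℂ) + 1) - 2) (j.1 + 1)) i j
        = (P + reflectMap (m + 1) M P).coeff (j + 1) := by
      simp only [Matrix.of_apply, mul_add, Finset.sum_add_distrib, coeff_add, mul_ite, mul_one,
        mul_zero, Finset.sum_ite_eq', Finset.mem_univ, if_true, reflectMap, finsetSum_coeff,
        coeff_C_mul]
      rw [Finset.sum_range_succ', hP0, zero_mul, add_zero, Finset.sum_range]
      congr 1
      refine Finset.sum_congr rfl fun i _ => ?_
      rw [← gbinom_neg M (i + 1) (j + 1) (by lia)]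
      push_cast
      rfl
    rw [hj]
    split_ifs with hl
    · simp [hl]
    · exact h _ (by have := Fin.val_ne_of_ne hl; simp at this; lia)

/-- The differential operator `x (1 - x) d/dx`. -/
noncomputable def logDeriv01 (f : ℂ[X]) : ℂ[X] := X * (1 - X) * derivative f

theorem logDeriv01_add (f g : ℂ[X]) : logDeriv01 (f + g) = logDeriv01 f + logDeriv01 g := by
  simp [logDeriv01, mul_add]

theorem logDeriv01_mul (f g : ℂ[X]) :
    logDeriv01 (f * g) = logDeriv01 f * g + f * logDeriv01 g := by
  simp only [logDeriv01, derivative_mul]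
  ring

theorem logDeriv01_C_mul (a : ℂ) (f : ℂ[X]) : logDeriv01 (C a * f) = C a * logDeriv01 f := by
  simp [logDeriv01, mul_left_comm]

theorem logDeriv01_X_pow (i : ℕ) : logDeriv01 (X ^ i) = C (i : ℂ) * (1 - X) * X ^ i := by
  cases i with
  | zero => simp [logDeriv01]
  | succ i =>
    simp only [logDeriv01, derivative_X_pow, Nat.add_sub_cancel]
    ring

theorem logDeriv01_one_sub_X_pow (j : ℕ) :
    logDeriv01 ((1 - X) ^ j) = -C (j : ℂ) * X * (1 - X) ^ j := by
  cases j with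
  | zero => simp [logDeriv01]
  | succ j =>
    simp only [logDeriv01, derivative_pow, derivative_sub, derivative_one, derivative_X,
      Nat.add_sub_cancel]
    ring

theorem logDeriv01_X_pow_mul_one_sub_X_pow (i j : ℕ) :
    logDeriv01 (X ^ i * (1 - X) ^ j)
      = (C (i : ℂ) - C ((i + j : ℕ) : ℂ) * X) * (X ^ i * (1 - X) ^ j) := by
  rw [logDeriv01_mul, logDeriv01_X_pow, logDeriv01_one_sub_X_pow]
  simp only [Nat.cast_add, map_add]
  ring

/-- A third order Fuchsian operator with singular points `0`, `1`, `∞` which is covariant under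
the permutations of these points. -/
noncomputable def fuchsOp (ν z : ℂ) (f : ℂ[X]) : ℂ[X] :=
  logDeriv01 (logDeriv01 (logDeriv01 f))
    + C (ν - 1) * (1 - 2 * X) * logDeriv01 (logDeriv01 f)
    - (C (ν + 2 * z) + C (ν ^ 2 - ν - 2 * z) * (X * (1 - X))) * logDeriv01 f
    + (1 - 2 * X) * (C (2 * z) + C ((ν + 1) * z) * (X * (1 - X))) * f

theorem fuchsOp_zero (ν z : ℂ) : fuchsOp ν z 0 = 0 := by
  simp [fuchsOp, logDeriv01]

theorem fuchsOp_add (ν z : ℂ) (f g : ℂ[X]) :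
    fuchsOp ν z (f + g) = fuchsOp ν z f + fuchsOp ν z g := by
  simp only [fuchsOp, logDeriv01_add]
  ring

theorem fuchsOp_C_mul (ν z a : ℂ) (f : ℂ[X]) : fuchsOp ν z (C a * f) = C a * fuchsOp ν z f := by
  simp only [fuchsOp, logDeriv01_C_mul]
  ring

theorem fuchsOp_of_logDeriv01_eq (ν z a b : ℂ) (f : ℂ[X])
    (h : logDeriv01 f = (C a - C b * X) * f) :
    fuchsOp ν z f = (-(C b * (X * (1 - X) * (1 - 2 * X)))
        - 3 * (C a - C b * X) * (C b * (X * (1 - X))) + (C a - C b * X) ^ 3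
      + C (ν - 1) * (1 - 2 * X) * (-(C b * (X * (1 - X))) + (C a - C b * X) ^ 2)
      - (C (ν + 2 * z) + C (ν ^ 2 - ν - 2 * z) * (X * (1 - X))) * (C a - C b * X)
      + (1 - 2 * X) * (C (2 * z) + C ((ν + 1) * z) * (X * (1 - X)))) * f := by
  have h1 : logDeriv01 (C a - C b * X) = -(C b * (X * (1 - X))) := by
    simp [logDeriv01]; ring
  have h2 : logDeriv01 (-(C b * (X * (1 - X)))) = -(C b * (X * (1 - X) * (1 - 2 * X))) := by
    simp [logDeriv01]; ring
  simp only [fuchsOp, h, logDeriv01_mul, logDeriv01_add, h1, h2]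
  ring

/-- The indicial polynomial of `fuchsOp` at `0`, for `z = n * (ν + 2 * n)`. -/
def indicial (ν n k : ℂ) : ℂ := (k - 1) * (k - 2 * n) * (k + ν + 2 * n)

/-- The indicial polynomial of `fuchsOp` at infinity in powers of `x (1 - x)`, for
`z = n * (ν + 2 * n)`. -/
def indicialInfty (ν n k : ℂ) : ℂ := (2 * k + ν + 1) * (2 * k + ν + 2 * n) * (k - n)

theorem fuchsOp_symm_pow (ν n : ℂ) (k : ℕ) :
    fuchsOp ν (n * (ν + 2 * n)) (X ^ k * (1 - X) ^ k)
      = (1 - 2 * X) * (C (indicial ν n k) * (X ^ k * (1 - X) ^ k)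
        - C (indicialInfty ν n k) * (X ^ (k + 1) * (1 - X) ^ (k + 1))) := by
  rw [fuchsOp_of_logDeriv01_eq _ _ _ _ _ (logDeriv01_X_pow_mul_one_sub_X_pow k k)]
  simp only [indicial, indicialInfty, Nat.cast_add, map_add, map_mul, map_sub, map_pow, map_one,
    map_ofNat]
  ring

theorem fuchsOp_reflect_pow (n : ℂ) (M k : ℕ) (h : 2 * (k + 1) ≤ M) :
    fuchsOp (-M) (n * (-M + 2 * n)) ((-X) ^ k * (1 - X) ^ (M - 2 * k))
      = (1 - X) ^ 2 * (1 + X) * (C (indicial (-M) n k) * ((-X) ^ k * (1 - X) ^ (M - 2 * k))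
        - C (indicialInfty (-M) n k) * ((-X) ^ (k + 1) * (1 - X) ^ (M - 2 * (k + 1)))) := by
  obtain ⟨r, rfl⟩ := Nat.exists_eq_add_of_le h
  rw [show 2 * (k + 1) + r - 2 * (k + 1) = r by lia, show 2 * (k + 1) + r - 2 * k = r + 2 by lia,
    neg_pow, show ((-1 : ℂ[X]) ^ k * X ^ k * (1 - X) ^ (r + 2))
      = C ((-1) ^ k) * (X ^ k * (1 - X) ^ (r + 2)) by simp [mul_assoc], fuchsOp_C_mul,
    fuchsOp_of_logDeriv01_eq _ _ _ _ _ (logDeriv01_X_pow_mul_one_sub_X_pow k (r + 2))]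
  simp only [indicial, indicialInfty, Nat.cast_add, Nat.cast_mul, map_add, map_mul, map_sub,
    map_pow, map_one, map_ofNat, map_neg, Nat.cast_ofNat, Nat.cast_one]
  ring

theorem logDeriv01_X_pow_mul (m : ℕ) (g : ℂ[X]) :
    logDeriv01 (X ^ m * g) = X ^ m * (C (m : ℂ) * (1 - X) * g + logDeriv01 g) := by
  rw [logDeriv01_mul, logDeriv01_X_pow]
  ring

theorem coeff_zero_logDeriv01 (g : ℂ[X]) : (logDeriv01 g).coeff 0 = 0 := by
  simp [logDeriv01]

theorem coeff_one_logDeriv01 (g : ℂ[X]) : (logDeriv01 g).coeff 1 = g.coeff 1 := by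
  simp [logDeriv01, mul_coeff_one, coeff_derivative]

theorem coeff_of_fuchsOp_eq_zero (ν n : ℂ) (m : ℕ) (g : ℂ[X])
    (h : fuchsOp ν (n * (ν + 2 * n)) (X ^ m * g) = 0) :
    indicial ν n m * g.coeff 0 = 0 ∧
    (m = 2 * n → m * (m + 1 + ν + 2 * n) * (2 * g.coeff 1 - (2 * n + ν) * g.coeff 0) = 0) := by
  obtain ⟨R, hR, hR'⟩ : ∃ R, R = 0 ∧ R =
      (C (m : ℂ) * (1 - X) * (C (m : ℂ) * (1 - X) * (C (m : ℂ) * (1 - X) * g + logDeriv01 g)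
          + logDeriv01 (C (m : ℂ) * (1 - X) * g + logDeriv01 g))
        + logDeriv01 (C (m : ℂ) * (1 - X) * (C (m : ℂ) * (1 - X) * g + logDeriv01 g)
          + logDeriv01 (C (m : ℂ) * (1 - X) * g + logDeriv01 g))
      + C (ν - 1) * (1 - 2 * X) * (C (m : ℂ) * (1 - X) * (C (m : ℂ) * (1 - X) * g + logDeriv01 g)
          + logDeriv01 (C (m : ℂ) * (1 - X) * g + logDeriv01 g))
      - (C (ν + 2 * (n * (ν + 2 * n))) + C (ν ^ 2 - ν - 2 * (n * (ν + 2 * n))) * (X * (1 - X)))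
        * (C (m : ℂ) * (1 - X) * g + logDeriv01 g)
      + (1 - 2 * X) * (C (2 * (n * (ν + 2 * n)))
        + C ((ν + 1) * (n * (ν + 2 * n))) * (X * (1 - X))) * g) := by
    refine ⟨_, ?_, rfl⟩
    refine (mul_eq_zero.1 (?_ : X ^ m * _ = 0)).resolve_left (pow_ne_zero m X_ne_zero)
    rw [← h, fuchsOp, logDeriv01_X_pow_mul, logDeriv01_X_pow_mul, logDeriv01_X_pow_mul]
    ring
  have h0 : R.coeff 0 = 0 := by simp [hR]
  have h1 : R.coeff 1 = 0 := by simp [hR]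
  have c2 : (2 : ℂ[X]).coeff 0 = 2 := by simp
  rw [hR'] at h0 h1
  simp only [coeff_add, coeff_sub, mul_coeff_zero, mul_coeff_one, coeff_zero_logDeriv01,
    coeff_one_logDeriv01, coeff_C_zero, coeff_C_succ, coeff_X_zero, coeff_X_one,
    coeff_one] at h0 h1
  simp [c2] at h0 h1
  refine ⟨?_, fun hm => ?_⟩
  · rw [indicial]
    linear_combination h0
  · obtain rfl : n = m / 2 := by rw [hm]; ring
    linear_combination 2 * h1

theorem X_pow_dvd_of_fuchsOp_eq_zero (ν : ℂ) (n : ℕ) (F : ℂ[X])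
    (h : fuchsOp ν (n * (ν + 2 * n)) F = 0) (h0 : F.coeff 0 = 0) (h1 : F.coeff 1 = 0)
    (hν : ∀ m : ℕ, m < 2 * n → (m : ℂ) + ν + 2 * n ≠ 0) (m : ℕ) (hm : m ≤ 2 * n) :
    X ^ m ∣ F := by
  induction m with
  | zero => simp
  | succ m ih =>
    obtain ⟨g, rfl⟩ := ih (by lia)
    suffices hg : g.coeff 0 = 0 by
      rw [pow_succ]
      exact mul_dvd_mul_left _ (X_dvd_iff.2 hg)
    rcases m with _ | _ | m
    · simpa using h0
    · simpa using h1
    · refine (mul_eq_zero.1 (coeff_of_fuchsOp_eq_zero _ _ _ _ h).1).resolve_left ?_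
      refine mul_ne_zero (mul_ne_zero ?_ ?_) (hν _ (by lia))
      · push_cast
        rw [show (m : ℂ) + 1 + 1 - 1 = (m + 1 : ℕ) by push_cast; ring]
        exact_mod_cast m.succ_ne_zero
      · rw [sub_ne_zero]
        exact_mod_cast (show m + 1 + 1 ≠ 2 * n by lia)

theorem coeff_of_X_pow_dvd_of_fuchsOp_eq_zero (ν : ℂ) (n : ℕ) (hn : n ≠ 0) (F : ℂ[X])
    (h : fuchsOp ν (n * (ν + 2 * n)) F = 0) (hF : X ^ (2 * n) ∣ F)
    (hν : (2 * n : ℂ) + 1 + ν + 2 * n ≠ 0) :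
    2 * F.coeff (2 * n + 1) = (2 * n + ν) * F.coeff (2 * n) := by
  obtain ⟨g, rfl⟩ := hF
  have hc := (coeff_of_fuchsOp_eq_zero _ _ _ _ h).2 (by push_cast; rfl)
  have e0 : (X ^ (2 * n) * g).coeff (2 * n) = g.coeff 0 := by
    simpa using coeff_X_pow_mul g (2 * n) 0
  have e1 : (X ^ (2 * n) * g).coeff (2 * n + 1) = g.coeff 1 := by
    rw [add_comm]
    exact coeff_X_pow_mul g (2 * n) 1
  rw [e0, e1]
  refine sub_eq_zero.1 ((mul_eq_zero.1 hc).resolve_left (mul_ne_zero ?_ ?_))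
  · exact_mod_cast (show 2 * n ≠ 0 by lia)
  · push_cast
    exact hν

/-- The coefficients, in powers of `x (1 - x)`, of the polynomial solution of the Fuchsian
equation `fuchsOp ν ((N + 1) * (ν + 2 * (N + 1))) f = 0`. -/
noncomputable def solutionCoeff (ν : ℂ) (N j : ℕ) : ℂ :=
  ∏ i ∈ Finset.range j, (2 * i + 3 + ν) * (2 * i + 2 * N + 4 + ν) * (N - i)
    / ((i + 1) * (2 * N - i) * (2 * N + 4 + i + ν))

theorem solutionCoeff_succ (ν : ℂ) (N j : ℕ) :
    solutionCoeff ν N (j + 1) = solutionCoeff ν N j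
      * ((2 * j + 3 + ν) * (2 * j + 2 * N + 4 + ν) * (N - j)
        / ((j + 1) * (2 * N - j) * (2 * N + 4 + j + ν))) := by
  rw [solutionCoeff, Finset.prod_range_succ, ← solutionCoeff]

theorem solutionCoeff_eq_zero (ν : ℂ) (N : ℕ) : solutionCoeff ν N (N + 1) = 0 := by
  simp [solutionCoeff_succ]

theorem solutionCoeff_succ_mul_indicial (ν : ℂ) (N j : ℕ) (hj : j ≤ N)
    (hν : (2 * N : ℂ) + 4 + j + ν ≠ 0) :
    solutionCoeff ν N (j + 1) * indicial ν (N + 1) (j + 1 + 1)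
      = solutionCoeff ν N j * indicialInfty ν (N + 1) (j + 1) := by
  rcases hj.eq_or_lt with rfl | hj
  · simp [solutionCoeff_eq_zero, indicialInfty]
  · have h1 : (j + 1 : ℂ) ≠ 0 := by exact_mod_cast j.succ_ne_zero
    have h2 : (2 * N - j : ℂ) ≠ 0 := by
      rw [sub_ne_zero]
      exact_mod_cast (show 2 * N ≠ j by lia)
    rw [solutionCoeff_succ, indicial, indicialInfty]
    field_simp
    ring

theorem sum_solutionCoeff_telescope (ν : ℂ) (N : ℕ) (f : ℕ → ℂ[X])
    (hν : ∀ j ≤ N, (2 * N : ℂ) + 4 + j + ν ≠ 0) :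
    ∑ j ∈ Finset.range (N + 1), C (solutionCoeff ν N j)
      * (C (indicial ν (N + 1) (j + 1)) * f (j + 1)
        - C (indicialInfty ν (N + 1) (j + 1)) * f (j + 2)) = 0 := by
  have key : ∀ J ≤ N + 1, ∑ j ∈ Finset.range J, C (solutionCoeff ν N j)
      * (C (indicial ν (N + 1) (j + 1)) * f (j + 1)
        - C (indicialInfty ν (N + 1) (j + 1)) * f (j + 2))
      = -(C (solutionCoeff ν N J * indicial ν (N + 1) (J + 1)) * f (J + 1)) := by
    intro J hJ
    induction J with
    | zero => simp [indicial]
    | succ J ih =>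
      rw [Finset.sum_range_succ, ih (by lia), Nat.cast_succ,
        solutionCoeff_succ_mul_indicial ν N J (by lia) (hν J (by lia))]
      simp only [map_mul]
      ring
  rw [key _ le_rfl, solutionCoeff_eq_zero]
  simp

/-- The solution of the Fuchsian equation that is symmetric under `x ↦ 1 - x`, for `ν = -M`. -/
noncomputable def symmSolution (M N : ℕ) : ℂ[X] :=
  ∑ j ∈ Finset.range (N + 1), C (solutionCoeff (-M) N j) * (X ^ (j + 1) * (1 - X) ^ (j + 1))

theorem fuchsOp_sum_C_mul (ν z : ℂ) (s : Finset ℕ) (p : ℕ → ℂ) (f : ℕ → ℂ[X]) :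
    fuchsOp ν z (∑ k ∈ s, C (p k) * f k) = ∑ k ∈ s, C (p k) * fuchsOp ν z (f k) := by
  induction s using Finset.cons_induction with
  | empty => simp [fuchsOp_zero]
  | cons a s ha ih => rw [Finset.sum_cons, Finset.sum_cons, fuchsOp_add, fuchsOp_C_mul, ih]

theorem reflectMap_symmSolution (M N : ℕ) (hM : 4 * N + 8 ≤ M) :
    reflectMap (2 * N + 1 + 1) M (symmSolution M N)
      = ∑ j ∈ Finset.range (N + 1), C (solutionCoeff (-M) N j)
        * ((-X) ^ (j + 1) * (1 - X) ^ (M - 2 * (j + 1))) := by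
  rw [symmSolution, reflectMap_sum_C_mul]
  refine Finset.sum_congr rfl fun j hj => ?_
  have := Finset.mem_range.1 hj
  rw [reflectMap_X_pow_mul _ _ (by lia) _ _ (by lia),
    show M - (j + 1) - (j + 1) = M - 2 * (j + 1) by lia]

theorem natCast_sub_ne_zero {a M : ℕ} (h : a < M) : (a : ℂ) + -M ≠ 0 := by
  rw [← sub_eq_add_neg, sub_ne_zero]
  exact_mod_cast h.ne

theorem fuchsOp_symmSolution_add (M N : ℕ) (hM : 4 * N + 8 ≤ M) :
    fuchsOp (-M) (((N + 1 : ℕ) : ℂ) * (-M + 2 * (N + 1 : ℕ)))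
      (symmSolution M N + reflectMap (2 * N + 1 + 1) M (symmSolution M N)) = 0 := by
  have hν : ∀ j ≤ N, (2 * N : ℂ) + 4 + j + -M ≠ 0 := fun j hj => by
    exact_mod_cast natCast_sub_ne_zero (show 2 * N + 4 + j < M by lia)
  have h1 := sum_solutionCoeff_telescope (-M) N (fun k => X ^ k * (1 - X) ^ k) hν
  have h2 := sum_solutionCoeff_telescope (-M) N (fun k => (-X) ^ k * (1 - X) ^ (M - 2 * k)) hν
  rw [fuchsOp_add, reflectMap_symmSolution M N hM, symmSolution, fuchsOp_sum_C_mul,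
    fuchsOp_sum_C_mul, ← add_zero (0 : ℂ[X])]
  congr 1
  · refine Eq.trans ?_ ((congrArg ((1 - 2 * X : ℂ[X]) * ·) h1).trans (mul_zero _))
    simp only [Finset.mul_sum]
    refine Finset.sum_congr rfl fun j _ => ?_
    rw [fuchsOp_symm_pow]
    push_cast
    ring
  · refine Eq.trans ?_
      ((congrArg (((1 - X) ^ 2 * (1 + X) : ℂ[X]) * ·) h2).trans (mul_zero _))
    simp only [Finset.mul_sum]
    refine Finset.sum_congr rfl fun j hj => ?_
    have := Finset.mem_range.1 hj
    rw [fuchsOp_reflect_pow _ _ _ (by lia)]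
    push_cast
    ring

theorem coeff_X_pow_mul_one_sub_X_pow (k b m : ℕ) (h : k ≤ m) :
    (X ^ k * (1 - X) ^ b : ℂ[X]).coeff m = (-1) ^ (m - k) * (b.choose (m - k) : ℂ) := by
  rw [coeff_X_pow_mul', if_pos h, coeff_one_sub_X_pow']

theorem coeff_neg_X_pow_mul_one_sub_X_pow (k b m : ℕ) (h : k ≤ m) :
    ((-X) ^ k * (1 - X) ^ b : ℂ[X]).coeff m = (-1) ^ m * (b.choose (m - k) : ℂ) := by
  rw [neg_pow, mul_assoc, show (-1 : ℂ[X]) ^ k = C ((-1) ^ k) by simp, coeff_C_mul,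
    coeff_X_pow_mul_one_sub_X_pow k b m h, ← mul_assoc, ← pow_add, Nat.add_sub_cancel' h]

theorem coeff_zero_symmSolution (M N : ℕ) : (symmSolution M N).coeff 0 = 0 := by
  simp [symmSolution, finsetSum_coeff]

theorem coeff_symmSolution_top (M N : ℕ) :
    (symmSolution M N).coeff (2 * N + 1 + 1) = (-1) ^ (N + 1) * solutionCoeff (-M) N N := by
  rw [symmSolution, finsetSum_coeff, Finset.sum_range_succ, Finset.sum_eq_zero, zero_add,
    coeff_C_mul, coeff_X_pow_mul_one_sub_X_pow _ _ _ (by lia),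
    show 2 * N + 1 + 1 - (N + 1) = N + 1 by lia]
  · simp [mul_comm]
  · intro j hj
    have := Finset.mem_range.1 hj
    rw [coeff_C_mul, coeff_X_pow_mul_one_sub_X_pow _ _ _ (by lia),
      Nat.choose_eq_zero_of_lt (by lia)]
    simp

theorem coeff_symmSolution_top_succ (M N : ℕ) :
    (symmSolution M N).coeff (2 * N + 2 + 1) = 0 := by
  rw [symmSolution, finsetSum_coeff]
  refine Finset.sum_eq_zero fun j hj => ?_
  have := Finset.mem_range.1 hj
  rw [coeff_C_mul, coeff_X_pow_mul_one_sub_X_pow _ _ _ (by lia),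
    Nat.choose_eq_zero_of_lt (by lia)]
  simp

theorem coeff_zero_symmSolution_add (M N : ℕ) (hM : 4 * N + 8 ≤ M) :
    (symmSolution M N + reflectMap (2 * N + 1 + 1) M (symmSolution M N)).coeff 0 = 0 := by
  rw [reflectMap_symmSolution M N hM, symmSolution, ← Finset.sum_add_distrib, finsetSum_coeff]
  refine Finset.sum_eq_zero fun j _ => ?_
  simp [pow_succ]

theorem coeff_one_symmSolution_add (M N : ℕ) (hM : 4 * N + 8 ≤ M) :
    (symmSolution M N + reflectMap (2 * N + 1 + 1) M (symmSolution M N)).coeff 1 = 0 := by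
  rw [reflectMap_symmSolution M N hM, symmSolution, ← Finset.sum_add_distrib, finsetSum_coeff]
  refine Finset.sum_eq_zero fun j _ => ?_
  rw [← mul_add, coeff_C_mul, coeff_add]
  cases j with
  | zero =>
    rw [coeff_X_pow_mul_one_sub_X_pow _ _ _ le_rfl, coeff_neg_X_pow_mul_one_sub_X_pow _ _ _ le_rfl]
    simp
  | succ j => simp [pow_succ, mul_assoc, mul_coeff_one]

theorem coeff_symmSolution_add_top_succ (M N : ℕ) (hM : 4 * N + 8 ≤ M) :
    (symmSolution M N + reflectMap (2 * N + 1 + 1) M (symmSolution M N)).coeff (2 * N + 2 + 1)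
      = -∑ j ∈ Finset.range (N + 1), solutionCoeff (-M) N j
        * ((M - 2 * (j + 1)).choose (2 * N + 2 - j) : ℂ) := by
  rw [coeff_add, coeff_symmSolution_top_succ, zero_add, reflectMap_symmSolution M N hM,
    finsetSum_coeff, ← Finset.sum_neg_distrib]
  refine Finset.sum_congr rfl fun j hj => ?_
  have := Finset.mem_range.1 hj
  rw [coeff_C_mul, coeff_neg_X_pow_mul_one_sub_X_pow _ _ _ (by lia),
    show 2 * N + 2 + 1 - (j + 1) = 2 * N + 2 - j by lia,
    Odd.neg_one_pow ⟨N + 1, by ring⟩]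
  ring

theorem X_pow_dvd_symmSolution_add (M N : ℕ) (hM : 4 * N + 8 ≤ M) :
    X ^ (2 * (N + 1))
      ∣ symmSolution M N + reflectMap (2 * N + 1 + 1) M (symmSolution M N) := by
  refine X_pow_dvd_of_fuchsOp_eq_zero (-M) (N + 1) _ (fuchsOp_symmSolution_add M N hM)
    (coeff_zero_symmSolution_add M N hM) (coeff_one_symmSolution_add M N hM) (fun m hm => ?_)
    _ le_rfl
  have := natCast_sub_ne_zero (show m + 2 * (N + 1) < M by lia)
  push_cast at this ⊢
  intro h
  exact this (by rw [← h]; ring)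

theorem coeff_symmSolution_add_top (M N : ℕ) (hM : 4 * N + 8 ≤ M) :
    (symmSolution M N + reflectMap (2 * N + 1 + 1) M (symmSolution M N)).coeff (2 * N + 1 + 1)
        * (-M / 2 + 1 + N)
      = -∑ j ∈ Finset.range (N + 1), solutionCoeff (-M) N j
        * ((M - 2 * (j + 1)).choose (2 * N + 2 - j) : ℂ) := by
  have h := coeff_of_X_pow_dvd_of_fuchsOp_eq_zero (-M) (N + 1) N.succ_ne_zero _
    (fuchsOp_symmSolution_add M N hM) (X_pow_dvd_symmSolution_add M N hM) ?_
  · rw [show 2 * (N + 1) + 1 = 2 * N + 2 + 1 by ring, coeff_symmSolution_add_top_succ M N hM,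
      show 2 * (N + 1) = 2 * N + 1 + 1 by ring] at h
    push_cast at h
    linear_combination (-1 / 2 : ℂ) * h
  · have := natCast_sub_ne_zero (show 4 * N + 5 < M by lia)
    push_cast at this ⊢
    intro h
    exact this (by rw [← h]; ring)

theorem mul_eq_mul_of_recurrence (X Y d u : ℕ → ℂ) (N : ℕ) (hd : ∀ j < N, d j ≠ 0)
    (hX : ∀ j < N, X (j + 1) * d j = X j * u j) (hY : ∀ j < N, Y (j + 1) * d j = Y j * u j)
    (j : ℕ) (hj : j ≤ N) : X j * Y 0 = Y j * X 0 := by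
  induction j with
  | zero => exact mul_comm _ _
  | succ j ih =>
    refine mul_right_cancel₀ (hd j hj) ?_
    linear_combination Y 0 * hX j hj - X 0 * hY j hj + u j * ih (by lia)

theorem choose_sub_two_mul (T r : ℕ) (hr : 1 ≤ r) (hT : r + 1 ≤ T) :
    ((T - 2).choose (r - 1) : ℂ) * (T * (T - 1)) = (T.choose r : ℂ) * (r * (T - r)) := by
  obtain ⟨r, rfl⟩ := Nat.exists_eq_add_of_le' hr
  obtain ⟨s, rfl⟩ := Nat.exists_eq_add_of_le' hT
  have h1 := Nat.add_one_mul_choose_eq (s + r + 1) r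
  have h2 := Nat.choose_mul_succ_eq (s + r) r
  rw [show s + (r + 1 + 1) - 2 = s + r by lia, show s + (r + 1 + 1) = s + r + 2 by ring,
    Nat.add_sub_cancel]
  rw [show s + r + 1 - r = s + 1 by lia] at h2
  have h1' : ((s : ℂ) + r + 1 + 1) * ((s + r + 1).choose r : ℂ)
      = ((s + r + 2).choose (r + 1) : ℂ) * (r + 1) := by exact_mod_cast h1
  have h2' : ((s + r).choose r : ℂ) * (s + r + 1) = ((s + r + 1).choose r : ℂ) * (s + 1) := by
    exact_mod_cast h2
  push_cast
  linear_combination (s + r + 2 : ℂ) * h2' + (s + 1 : ℂ) * h1'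

theorem solutionCoeff_mul_choose_succ (M N j : ℕ) (hM : 4 * N + 8 ≤ M) (hj : j < N) :
    solutionCoeff (-M) N (j + 1) * ((M - 2 * (j + 1 + 1)).choose (2 * N + 2 - (j + 1)) : ℂ)
        * ((j + 1) * (-M / 2 + 1 + j) * (2 * N - j))
      = solutionCoeff (-M) N j * ((M - 2 * (j + 1)).choose (2 * N + 2 - j) : ℂ)
        * ((N - j) * (-M / 2 + N + 2 + j) * (-2 * N - 2 + j)) := by
  have h := choose_sub_two_mul (M - 2 * (j + 1)) (2 * N + 2 - j) (by lia) (by lia)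
  rw [show M - 2 * (j + 1) - 2 = M - 2 * (j + 1 + 1) by lia,
    show 2 * N + 2 - j - 1 = 2 * N + 2 - (j + 1) by lia, Nat.cast_sub (by lia),
    Nat.cast_sub (by lia)] at h
  generalize ((M - 2 * (j + 1 + 1)).choose (2 * N + 2 - (j + 1)) : ℂ) = B' at h ⊢
  generalize ((M - 2 * (j + 1)).choose (2 * N + 2 - j) : ℂ) = B at h ⊢
  push_cast at h
  have h1 : (j + 1 : ℂ) ≠ 0 := by exact_mod_cast j.succ_ne_zero
  have h2 : (2 * N - j : ℂ) ≠ 0 := by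
    rw [sub_ne_zero]
    exact_mod_cast (show 2 * N ≠ j by lia)
  have h3 : (2 * N + 4 + j + -M : ℂ) ≠ 0 := by
    exact_mod_cast natCast_sub_ne_zero (show 2 * N + 4 + j < M by lia)
  have h4 : (2 * j + 3 + -M : ℂ) ≠ 0 := by
    exact_mod_cast natCast_sub_ne_zero (show 2 * j + 3 < M by lia)
  have hp : solutionCoeff (-M) N (j + 1) * ((j + 1) * (2 * N - j) * (2 * N + 4 + j + -M))
      = solutionCoeff (-M) N j * ((2 * j + 3 + -M) * (2 * j + 2 * N + 4 + -M) * (N - j)) := by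
    rw [solutionCoeff_succ]
    field_simp
  generalize solutionCoeff (-M) N (j + 1) = p' at hp ⊢
  generalize solutionCoeff (-M) N j = p at hp ⊢
  refine mul_right_cancel₀ (mul_ne_zero h3 h4) ?_
  linear_combination (B' * (-M / 2 + 1 + j) * (2 * j + 3 + -M)) * hp
    + (p * (2 * j + 3 + -M) * (2 * j + 2 * N + 4 + -M) * (N - j) / 2) * h

theorem saalschutz_term_succ (a b c : ℂ) (N j : ℕ) (hj : j < N) :
    (N.choose (j + 1) : ℂ) * poch a (j + 1) * poch b (j + 1) * poch (c + (j + 1 : ℕ)) (N - (j + 1))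
        * poch (N + 1) (N - (j + 1)) * ((j + 1) * (c + j) * (2 * N - j))
      = (N.choose j : ℂ) * poch a j * poch b j * poch (c + j) (N - j) * poch (N + 1) (N - j)
        * ((N - j) * (a + j) * (b + j)) := by
  obtain ⟨r, rfl⟩ := Nat.exists_eq_add_of_lt hj
  have h := Nat.choose_succ_right_eq (j + r + 1) j
  rw [show j + r + 1 - j = r + 1 by lia] at h
  have h' : ((j + r + 1).choose (j + 1) : ℂ) * (j + 1) = (j + r + 1).choose j * (r + 1) := by
    exact_mod_cast h
  rw [show j + r + 1 - (j + 1) = r by lia, show j + r + 1 - j = r + 1 by lia, poch_succ a,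
    poch_succ b, poch_succ_left (c + j), poch_succ _ r]
  push_cast
  rw [add_assoc c]
  linear_combination (poch a j * (a + j) * (poch b j * (b + j)) * poch (c + (j + 1)) r
    * poch (j + r + 1 + 1) r * (c + j) * (j + 2 * r + 2)) * h'

theorem poch_two (N : ℕ) : poch 2 N = ((N + 1).factorial : ℂ) := by
  induction N with
  | zero => simp [poch]
  | succ N ih =>
    rw [poch_succ, ih, Nat.factorial_succ (N + 1)]
    push_cast
    ring

theorem sum_solutionCoeff_mul_choose (M N : ℕ) (hM : 4 * N + 8 ≤ M) :
    (∑ j ∈ Finset.range (N + 1), solutionCoeff (-M) N j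
        * ((M - 2 * (j + 1)).choose (2 * N + 2 - j) : ℂ))
        * (poch (-M / 2 + 1) N * poch (N + 1) N)
      = ((M - 2).choose (2 * N + 2) : ℂ) * ((-1) ^ N * ((N + 1).factorial : ℂ)
        * poch (-M / 2 + 2 * N + 3) N) := by
  have hs := saalschutz (-M / 2 + N + 2) (-2 * N - 2) (-M / 2 + 1) N
  rw [show (-M / 2 + 1 - (-M / 2 + N + 2) - (-2 * N - 2) : ℂ) = N + 1 by ring,
    show (-M / 2 + 1 - (-M / 2 + N + 2) : ℂ) = -(N + 1) by ring,
    show (-M / 2 + 1 - (-2 * N - 2) : ℂ) = -M / 2 + 2 * N + 3 by ring, poch_neg,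
    show (N + 1 - N + 1 : ℂ) = 2 by ring, poch_two] at hs
  have key := mul_eq_mul_of_recurrence
    (fun j => (N.choose j : ℂ) * poch (-M / 2 + N + 2) j * poch (-2 * N - 2) j
      * poch (-M / 2 + 1 + j) (N - j) * poch (N + 1) (N - j))
    (fun j => solutionCoeff (-M) N j * ((M - 2 * (j + 1)).choose (2 * N + 2 - j) : ℂ))
    (fun j => (j + 1) * (-M / 2 + 1 + j) * (2 * N - j))
    (fun j => (N - j) * (-M / 2 + N + 2 + j) * (-2 * N - 2 + j)) N ?_
    (fun j hj => saalschutz_term_succ _ _ _ N j hj)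
    (fun j hj => solutionCoeff_mul_choose_succ M N j hM hj)
  · rw [← hs, Finset.sum_mul, Finset.mul_sum]
    refine Finset.sum_congr rfl fun j hj => ?_
    have := key j (Nat.le_of_lt_succ (Finset.mem_range.1 hj))
    simp only [solutionCoeff, Finset.range_zero, Finset.prod_empty, poch_zero, Nat.choose_zero_right,
      Nat.cast_zero, Nat.cast_one, add_zero, one_mul, Nat.sub_zero, zero_add, mul_one] at this ⊢
    linear_combination -this
  · intro j hj
    refine mul_ne_zero (mul_ne_zero (by exact_mod_cast j.succ_ne_zero) ?_) ?_
    · have := natCast_sub_ne_zero (show 2 * j + 2 < M by lia)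
      push_cast at this
      intro h
      exact this (by linear_combination 2 * h)
    · rw [sub_ne_zero]
      exact_mod_cast (show 2 * N ≠ j by lia)

theorem poch_succ_natCast_mul_factorial (N k : ℕ) :
    poch (N + 1) k * (N.factorial : ℂ) = ((N + k).factorial : ℂ) := by
  induction k with
  | zero => simp [poch]
  | succ k ih =>
    rw [poch_succ, ← add_assoc, Nat.factorial_succ]
    push_cast
    rw [← ih]
    ring

theorem choose_mul_factorial_eq_poch (M N : ℕ) (hM : 4 * N + 8 ≤ M) :
    ((M - 2).choose (2 * N + 2) : ℂ) * (2 * (2 * N + 1) * ((N + 1).factorial : ℂ)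
        * poch (N + 1) N)
      = 4 ^ (N + 1) * (poch (-M / 2 + 1) N * (-M / 2 + 1 + N))
        * (poch (-M / 2 + 3 / 2) N * (-M / 2 + 3 / 2 + N)) := by
  have h1 : (2 * (2 * N + 1) * ((N + 1).factorial : ℂ) * poch (N + 1) N)
      = ((2 * N + 2).factorial : ℂ) := by
    have := poch_succ_natCast_mul_factorial N N
    rw [Nat.factorial_succ, show 2 * N + 2 = N + N + 1 + 1 by ring, Nat.factorial_succ,
      Nat.factorial_succ]
    push_cast
    linear_combination (2 * (2 * N + 1) * (N + 1) : ℂ) * this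
  have h2 : ((M - 2).choose (2 * N + 2) : ℂ) * ((2 * N + 2).factorial : ℂ)
      = poch (-M + 2) (2 * (N + 1)) := by
    rw [Nat.cast_choose_eq_descPochhammer_div, descPochhammer_eval_eq_prod_range,
      div_mul_cancel₀ _ (by exact_mod_cast Nat.factorial_ne_zero _), poch, mul_add_one]
    rw [← one_mul (∏ i ∈ Finset.range (2 * N + 2), (((M - 2 : ℕ) : ℂ) - (i : ℕ))),
      show (1 : ℂ) = (-1) ^ (2 * N + 2) from (Even.neg_one_pow ⟨N + 1, by ring⟩).symm]
    nth_rw 1 [← Finset.card_range (2 * N + 2)]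
    rw [← Finset.prod_const, ← Finset.prod_mul_distrib]
    refine Finset.prod_congr rfl fun i _ => ?_
    rw [Nat.cast_sub (by lia)]
    push_cast
    ring
  rw [h1, h2, poch_double, poch_succ, poch_succ, pow_mul]
  rw [show (-M + 2 : ℂ) / 2 = -M / 2 + 1 by ring, show (-M + 2 + 1 : ℂ) / 2 = -M / 2 + 3 / 2 by ring]
  norm_num

theorem solutionCoeff_top_mul (M N : ℕ) (hM : 4 * N + 8 ≤ M) :
    solutionCoeff (-M) N N * poch (N + 1) N * poch (-M + 2 * N + 4) N
      = 4 ^ N * poch (-M / 2 + 3 / 2) N * poch (-M / 2 + N + 2) N := by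
  have h1 : ∏ i ∈ Finset.range N, ((N : ℂ) - i) = ∏ i ∈ Finset.range N, ((i : ℂ) + 1) := by
    rw [← Finset.prod_range_reflect]
    refine Finset.prod_congr rfl fun i hi => ?_
    have := Finset.mem_range.1 hi
    rw [Nat.sub_sub, Nat.cast_sub (by lia)]
    push_cast
    ring
  have h2 : ∏ i ∈ Finset.range N, (2 * (N : ℂ) - i) = poch (N + 1) N := by
    rw [poch, ← Finset.prod_range_reflect]
    refine Finset.prod_congr rfl fun i hi => ?_
    have := Finset.mem_range.1 hi
    rw [Nat.sub_sub, Nat.cast_sub (by lia)]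
    push_cast
    ring
  have h3 : ∏ i ∈ Finset.range N, (2 * (N : ℂ) + 4 + i + -M) = poch (-M + 2 * N + 4) N :=
    Finset.prod_congr rfl fun i hi => by ring
  have h4 : ∏ i ∈ Finset.range N, (2 * (i : ℂ) + 3 + -M) = 2 ^ N * poch (-M / 2 + 3 / 2) N := by
    nth_rw 2 [← Finset.card_range N]
    rw [poch, ← Finset.prod_const, ← Finset.prod_mul_distrib]
    exact Finset.prod_congr rfl fun i hi => by ring
  have h5 : ∏ i ∈ Finset.range N, (2 * (i : ℂ) + 2 * N + 4 + -M)
      = 2 ^ N * poch (-M / 2 + N + 2) N := by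
    nth_rw 3 [← Finset.card_range N]
    rw [poch, ← Finset.prod_const, ← Finset.prod_mul_distrib]
    exact Finset.prod_congr rfl fun i hi => by ring
  have n1 : ∏ i ∈ Finset.range N, ((i : ℂ) + 1) ≠ 0 :=
    Finset.prod_ne_zero_iff.2 fun i _ => by exact_mod_cast i.succ_ne_zero
  have n2 : poch ((N : ℂ) + 1) N ≠ 0 := poch_ne_zero fun i _ => by
    exact_mod_cast (show N + 1 + i ≠ 0 by lia)
  have n3 : poch (-M + 2 * (N : ℂ) + 4) N ≠ 0 := poch_ne_zero fun i hi => by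
    have := natCast_sub_ne_zero (show 2 * N + 4 + i < M by lia)
    push_cast at this
    intro h
    exact this (by rw [← h]; ring)
  rw [solutionCoeff, Finset.prod_div_distrib]
  simp only [Finset.prod_mul_distrib]
  rw [h1, h2, h3, h4, h5, show (4 : ℂ) ^ N = 2 ^ N * 2 ^ N by rw [← mul_pow]; norm_num]
  generalize poch (-M + 2 * N + 4 : ℂ) N = W at *
  field_simp

theorem coeff_symmSolution_add_top_mul (M N : ℕ) (hM : 4 * N + 8 ≤ M) :
    (symmSolution M N + reflectMap (2 * N + 1 + 1) M (symmSolution M N)).coeff (2 * N + 1 + 1)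
        * ((2 * N + 1) * poch (N + 1) N) * poch (-M / 2 + N + 2) N
      = (-1) ^ (N + 1) * solutionCoeff (-M) N N * ((-M + 2 * N + 3) * poch (-M + 2 * N + 4) N)
        * poch (-M / 2 + 2 * N + 3) N := by
  have e1 := coeff_symmSolution_add_top M N hM
  have e2 := sum_solutionCoeff_mul_choose M N hM
  have e3 := choose_mul_factorial_eq_poch M N hM
  have e4 := solutionCoeff_top_mul M N hM
  have n1 : (-M / 2 + 1 + N : ℂ) ≠ 0 := fun h =>
    natCast_sub_ne_zero (show 2 * N + 2 < M by lia) (by push_cast; linear_combination 2 * h)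
  have n2 : poch (-M / 2 + 1 : ℂ) N ≠ 0 := poch_ne_zero fun i hi h =>
    natCast_sub_ne_zero (show 2 * i + 2 < M by lia) (by push_cast; linear_combination 2 * h)
  have n3 : poch ((N : ℂ) + 1) N ≠ 0 := poch_ne_zero fun i _ => by
    exact_mod_cast (show N + 1 + i ≠ 0 by lia)
  have n4 : ((N + 1).factorial : ℂ) ≠ 0 := by exact_mod_cast Nat.factorial_ne_zero _
  generalize (symmSolution M N + reflectMap (2 * N + 1 + 1) M (symmSolution M N)).coeff
    (2 * N + 1 + 1) = S at *
  generalize ∑ j ∈ Finset.range (N + 1), solutionCoeff (-M) N j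
        * ((M - 2 * (j + 1)).choose (2 * N + 2 - j) : ℂ) = V at *
  generalize ((M - 2).choose (2 * N + 2) : ℂ) = Y at *
  generalize solutionCoeff (-M) N N = p at *
  generalize poch (-M / 2 + 1 : ℂ) N = C1 at *
  generalize poch ((N : ℂ) + 1) N = E at *
  generalize ((N + 1).factorial : ℂ) = f at *
  generalize poch (-M / 2 + 3 / 2 : ℂ) N = T at *
  generalize poch (-M / 2 + N + 2 : ℂ) N = A at *
  generalize poch (-M / 2 + 2 * N + 3 : ℂ) N = H at *
  generalize poch (-M + 2 * N + 4 : ℂ) N = W at *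
  refine mul_right_cancel₀ (mul_ne_zero (mul_ne_zero (mul_ne_zero n1 n2) n3) n4) ?_
  refine mul_left_cancel₀ n3 ?_
  rw [pow_succ] at e3 ⊢
  linear_combination ((2 * N + 1) * E * A * C1 * E * f * E) * e1
    - ((2 * N + 1) * E * A * f * E) * e2
    - ((-1) ^ N * f * H * A * E / 2) * e3
    + (2 * (-1) ^ N * f * H * C1 * E * (-M / 2 + 1 + N) * (-M / 2 + 3 / 2 + N)) * e4

theorem neg_one_pow_triangle (N : ℕ) : (-1 : ℂ) ^ (N * (N - 1) / 2) = (-1) ^ (N / 2) := by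
  obtain ⟨k, rfl | rfl⟩ := N.even_or_odd'
  · rw [mul_assoc, Nat.mul_div_cancel_left _ two_pos, Nat.mul_div_cancel_left _ two_pos]
    cases k with
    | zero => simp
    | succ k =>
      rw [mul_comm, pow_mul, Odd.neg_one_pow ⟨k, by lia⟩]
  · rw [Nat.add_sub_cancel, mul_left_comm, Nat.mul_div_cancel_left _ two_pos, pow_mul,
      Odd.neg_one_pow ⟨k, rfl⟩]
    congr 1
    lia

theorem poch_mul_poch_floor (μ : ℂ) (N : ℕ) :
    poch (μ + 2 * (N + 1)) (N + 1) * poch ((-μ - 4 * (N + 1) + 3) / 2) (N / 2)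
      = (-1) ^ (N * (N - 1) / 2) * 2 ^ (N + 1) * poch ((μ + 2 * (N + 1)) / 2) ((N + 1 + 1) / 2)
        * poch ((μ + 2 * (N + 1) + 1) / 2) N := by
  have h : ((N : ℂ)) = ((N + 1) / 2 : ℕ) + (N / 2 : ℕ) := by
    exact_mod_cast (show N = (N + 1) / 2 + N / 2 by lia)
  have h2 : poch ((μ + 2 * (N + 1) + 1) / 2) N = poch ((μ + 2 * (N + 1) + 1) / 2) ((N + 1) / 2)
      * poch ((μ + 2 * (N + 1) + 1) / 2 + ((N + 1) / 2 : ℕ)) (N / 2) := by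
    rw [← poch_add]
    congr 1
    lia
  rw [poch_split_parity, neg_one_pow_triangle, h2,
    show (-μ - 4 * (N + 1) + 3) / 2 = -((μ + 4 * N + 1) / 2) by ring, poch_neg,
    show (μ + 4 * N + 1) / 2 - (N / 2 : ℕ) + 1
      = (μ + 2 * (N + 1) + 1) / 2 + ((N + 1) / 2 : ℕ) by linear_combination h]
  ring

theorem D1_quotient_of_neg (M N : ℕ) (hM : 4 * N + 8 ≤ M) :
    D1 (1 - M) (2 * N + 1 + 1) * poch (N + 1) (N + 1)
        * poch ((-(1 - M) - 4 * (N + 1) + 3) / 2) (N / 2)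
      = (-1) ^ (N * (N - 1) / 2) * 2 ^ (N + 1)
        * poch ((1 - M + 2 * (N + 1)) / 2) ((N + 1 + 1) / 2)
        * poch ((1 - M + 4 * (N + 1) + 1) / 2) N * D1 (1 - M) (2 * N + 1) := by
  have e1 := D1_mul_of_coeff_eq_zero (2 * N + 1) M (by lia) _ (coeff_zero_symmSolution M N)
    (X_pow_dvd_iff.1 (X_pow_dvd_symmSolution_add M N hM))
  have e2 := coeff_symmSolution_add_top_mul M N hM
  have e3 := poch_mul_poch_floor (1 - M) N
  have e4 := solutionCoeff_top_mul M N hM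
  have hA : poch (-M / 2 + N + 2 : ℂ) N ≠ 0 := poch_ne_zero fun i hi h =>
    natCast_sub_ne_zero (show 2 * N + 4 + 2 * i < M by lia) (by push_cast; linear_combination 2 * h)
  have hT : poch (-M / 2 + 3 / 2 : ℂ) N ≠ 0 := poch_ne_zero fun i hi h =>
    natCast_sub_ne_zero (show 2 * i + 3 < M by lia) (by push_cast; linear_combination 2 * h)
  have hp : solutionCoeff (-M) N N ≠ 0 := by
    intro h
    rw [h, zero_mul, zero_mul] at e4
    exact mul_ne_zero (mul_ne_zero (pow_ne_zero _ (by norm_num)) hT) hA e4.symm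
  rw [coeff_symmSolution_top] at e1
  rw [poch_succ_left, show (1 - M + 2 * (N + 1) : ℂ) + 1 = -M + 2 * N + 4 by ring,
    show (-M + 2 * N + 4 : ℂ) / 2 = -M / 2 + N + 2 by ring] at e3
  rw [poch_succ, show (1 - M + 4 * (N + 1) + 1 : ℂ) / 2 = -M / 2 + 2 * N + 3 by ring]
  refine mul_left_cancel₀ hA (mul_left_cancel₀ hp
    (mul_left_cancel₀ (pow_ne_zero (N + 1) (neg_ne_zero.2 one_ne_zero)) ?_))
  linear_combination (poch (N + 1) N * (N + 1 + N) * poch (-M / 2 + N + 2) N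
      * poch ((-(1 - M) - 4 * (N + 1) + 3) / 2) (N / 2)) * e1
    + (D1 (1 - M) (2 * N + 1) * poch ((-(1 - M) - 4 * (N + 1) + 3) / 2) (N / 2)) * e2
    + ((-1) ^ (N + 1) * solutionCoeff (-M) N N * poch (-M / 2 + 2 * N + 3) N
      * D1 (1 - M) (2 * N + 1)) * e3

theorem exists_eval_eq_poch (a b : ℂ) (k : ℕ) : ∃ q : ℂ[X], ∀ x, poch (a * x + b) k = q.eval x :=
  ⟨∏ i ∈ Finset.range k, (C a * X + C b + C (i : ℂ)), fun x => by simp [poch, eval_prod]⟩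

theorem exists_eval_eq_D1 (m : ℕ) : ∃ q : ℂ[X], ∀ x, D1 x m = q.eval x := by
  refine ⟨Matrix.det (Matrix.of fun i j : Fin m => (if i = j then (1 : ℂ[X]) else 0)
    + C ((j.1 + 1).factorial : ℂ)⁻¹ * ∏ l ∈ Finset.range (j.1 + 1),
      (X + C ((i.1 : ℂ) + 1) + C ((j.1 : ℂ) + 1) - 2 - C (l : ℂ))), fun x => ?_⟩
  rw [← coe_evalRingHom, RingHom.map_det, D1]
  congr 1
  ext i j
  simp only [Matrix.of_apply, RingHom.mapMatrix_apply, Matrix.map_apply, coe_evalRingHom, gbinom,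
    eval_add, eval_mul, eval_sub, eval_prod, eval_X, eval_C, eval_ofNat, div_eq_inv_mul]
  split_ifs <;> simp

/-- Polynomial functions agreeing at all sufficiently small integers are equal. -/
theorem eq_of_forall_eval_one_sub_eq (p q : ℂ[X]) (M₀ : ℕ)
    (h : ∀ M : ℕ, M₀ ≤ M → p.eval (1 - M : ℂ) = q.eval (1 - M : ℂ)) : p = q := by
  refine eq_of_infinite_eval_eq p q (Set.Infinite.mono ?_
    (Set.infinite_range_of_injective (f := fun k : ℕ => (1 - (M₀ + k : ℕ) : ℂ)) ?_))
  · rintro _ ⟨k, rfl⟩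
    exact h _ (Nat.le_add_right _ _)
  · intro k l hkl
    simpa using hkl

/-- Andrews's determinant quotient (Theorem 1 / Problem 34), in
denominator-cleared form. -/
theorem andrews_determinant_quotient (μ : ℂ) (n : ℕ) (hn : 1 ≤ n) :
    D1 μ (2 * n) * poch (n : ℂ) n * poch ((-μ - 4 * n + 3) / 2) ((n - 1) / 2)
      = (-1) ^ ((n - 1) * (n - 2) / 2) * 2 ^ n * poch ((μ + 2 * n) / 2) ((n + 1) / 2)
        * poch ((μ + 4 * n + 1) / 2) (n - 1) * D1 μ (2 * n - 1) := by
  obtain ⟨N, rfl⟩ := Nat.exists_eq_add_of_le' hn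
  obtain ⟨d, hd⟩ := exists_eval_eq_D1 (2 * N + 1 + 1)
  obtain ⟨d', hd'⟩ := exists_eval_eq_D1 (2 * N + 1)
  obtain ⟨q₁, h₁⟩ := exists_eval_eq_poch (-1 / 2) ((-4 * (N + 1) + 3) / 2) (N / 2)
  obtain ⟨q₂, h₂⟩ := exists_eval_eq_poch (1 / 2) (N + 1) ((N + 1 + 1) / 2)
  obtain ⟨q₃, h₃⟩ := exists_eval_eq_poch (1 / 2) ((4 * (N + 1) + 1) / 2) N
  replace h₁ : ∀ x : ℂ, poch ((-x - 4 * (N + 1) + 3) / 2) (N / 2) = q₁.eval x := fun x => by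
    rw [← h₁]; congr 1; ring
  replace h₂ : ∀ x : ℂ, poch ((x + 2 * (N + 1)) / 2) ((N + 1 + 1) / 2) = q₂.eval x := fun x => by
    rw [← h₂]; congr 1; ring
  replace h₃ : ∀ x : ℂ, poch ((x + 4 * (N + 1) + 1) / 2) N = q₃.eval x := fun x => by
    rw [← h₃]; congr 1; ring
  have key : d * C (poch (N + 1) (N + 1)) * q₁
      = C ((-1) ^ (N * (N - 1) / 2) * 2 ^ (N + 1)) * q₂ * q₃ * d' :=
    eq_of_forall_eval_one_sub_eq _ _ (4 * N + 8) fun M hM => by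
      simpa only [eval_mul, eval_C, ← hd, ← hd', ← h₁, ← h₂, ← h₃] using D1_quotient_of_neg M N hM
  have := congrArg (eval μ) key
  simp only [eval_mul, eval_C, ← hd, ← hd', ← h₁, ← h₂, ← h₃] at this
  rw [show 2 * (N + 1) - 1 = 2 * N + 1 by lia, show 2 * (N + 1) = 2 * N + 1 + 1 by ring,
    show N + 1 - 2 = N - 1 by lia, Nat.add_sub_cancel]
  push_cast
  exact this
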